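/- Let n be a positive integer, δ ∈ {0,1}, and q ∈ ℂ with 0 < |q| < 1, with a fixed square root q^{1/2}. Then 2 q^{C(n,2)(1−n−3δ/2)} · det_{1≤i,j≤n}( π_{δ+i−j}(q) ) = det_{1≤i,j≤n}( q^{(j−1)(n−i+δ/2)} θ(q^{4n+2δ+1−4i+j}; q^5) + q^{−(j−1)(n−i+δ/2)} θ(q^{4n+2δ+3−4i−j}; q^5) ), a determinant transformation identity equating an A_n-type Toeplitz determinant of the functions π_k with a D_n-type determinant of theta functions. -/

import Mathlib

noncomputable section

/-- `(a;q)_∞ = ∏_{i ≥ 0} (1 - a q^i)`. -/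
def qPI (a q : ℂ) : ℂ := ∏' i : ℕ, (1 - a * q ^ i)

/-- `θ(z;q) = (z;q)_∞ (q/z;q)_∞`. -/
def tht (z q : ℂ) : ℂ := qPI z q * qPI (q / z) q

/-- Forward recursion `X_k = X_{k-1} + q^k X_{k-2}` with `X 0 = x0`, `X 1 = x1`. -/
def schurFwd (q x0 x1 : ℂ) : ℕ → ℂ
  | 0 => x0
  | 1 => x1
  | (m + 2) => schurFwd q x0 x1 (m + 1) + q ^ (m + 2) * schurFwd q x0 x1 m

/-- Backward extension: `schurBwd q x0 x1 m = X_{-m}`. -/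
def schurBwd (q x0 x1 : ℂ) : ℕ → ℂ
  | 0 => x0
  | 1 => (x1 - x0) / q
  | (m + 2) => (schurBwd q x0 x1 m - schurBwd q x0 x1 (m + 1)) * q ^ m

/-- The two-sided solution of the Schur recursion on `ℤ`. -/
def schurSeq (q x0 x1 : ℂ) (k : ℤ) : ℂ :=
  if 0 ≤ k then schurFwd q x0 x1 k.toNat else schurBwd q x0 x1 (-k).toNat

/-- The Schur polynomials `D_k(q)`, `k ∈ ℤ`. -/
def schurD (q : ℂ) : ℤ → ℂ := schurSeq q 1 (1 + q)

/-- The Schur polynomials `E_k(q)`, `k ∈ ℤ`. -/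
def schurE (q : ℂ) : ℤ → ℂ := schurSeq q 1 1

/-- `π_k(q) = (-1)^k q^{-C(k,2)} (θ(q²;q⁵) E_{k-2}(q) - θ(q;q⁵) D_{k-2}(q))`. -/
def piK (q : ℂ) (k : ℤ) : ℂ :=
  (-1 : ℂ) ^ k * q ^ (-(k * (k - 1) / 2)) *
    (tht (q ^ 2) (q ^ 5) * schurE q (k - 2) - tht q (q ^ 5) * schurD q (k - 2))

open Polynomial

section Theta

theorem multipliable_one_sub_mul_pow (a : ℂ) {q : ℂ} (hq : ‖q‖ < 1) :
    Multipliable fun i : ℕ => 1 - a * q ^ i := by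
  have h : Summable fun i : ℕ => ‖-(a * q ^ i)‖ := by
    simpa using (summable_geometric_of_lt_one (norm_nonneg q) hq).mul_left ‖a‖
  simpa [sub_eq_add_neg] using multipliable_one_add_of_summable h

theorem qPI_eq_one_sub_mul (a : ℂ) {q : ℂ} (hq : ‖q‖ < 1) :
    qPI a q = (1 - a) * qPI (a * q) q := by
  have h := multipliable_one_sub_mul_pow (a * q) hq
  simp only [mul_assoc, ← pow_succ'] at h
  unfold qPI
  rw [tprod_eq_zero_mul' (f := fun i : ℕ => 1 - a * q ^ i) h]
  simp only [pow_zero, mul_one, mul_assoc, ← pow_succ']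

theorem tht_mul_base {z q : ℂ} (hz : z ≠ 0) (hq0 : q ≠ 0) (hq : ‖q‖ < 1) :
    tht (z * q) q = -z⁻¹ * tht z q := by
  have h1 := qPI_eq_one_sub_mul z hq
  have h2 := qPI_eq_one_sub_mul z⁻¹ hq
  have e1 : q / (z * q) = z⁻¹ := by field_simp
  have e2 : q / z = z⁻¹ * q := by field_simp
  unfold tht
  rw [e1, e2, h1, h2]
  linear_combination (-qPI (z * q) q * qPI (z⁻¹ * q) q) * mul_inv_cancel₀ hz

theorem tht_base_div {z q : ℂ} (hz : z ≠ 0) (hq0 : q ≠ 0) : tht (q / z) q = tht z q := by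
  have e : q / (q / z) = z := by field_simp
  unfold tht
  rw [e, mul_comm]

theorem tht_zpow_add_five {q : ℂ} (hq0 : q ≠ 0) (hq : ‖q‖ < 1) (k : ℤ) :
    tht (q ^ (k + 5)) (q ^ 5) = -q ^ (-k) * tht (q ^ k) (q ^ 5) := by
  have h5 : ‖q ^ 5‖ < 1 := by
    rw [norm_pow]
    exact pow_lt_one₀ (norm_nonneg q) hq (by norm_num)
  have h := tht_mul_base (zpow_ne_zero k hq0) (pow_ne_zero 5 hq0) h5
  rw [zpow_neg, zpow_add₀ hq0]
  exact_mod_cast h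

theorem tht_zpow_five_sub {q : ℂ} (hq0 : q ≠ 0) (k : ℤ) :
    tht (q ^ (5 - k)) (q ^ 5) = tht (q ^ k) (q ^ 5) := by
  have h := tht_base_div (zpow_ne_zero k hq0) (pow_ne_zero 5 hq0)
  rw [zpow_sub₀ hq0]
  exact_mod_cast h

end Theta

section Schur

theorem schurSeq_rec {q : ℂ} (hq0 : q ≠ 0) (x0 x1 : ℂ) (k : ℤ) :
    schurSeq q x0 x1 k = schurSeq q x0 x1 (k - 1) + q ^ k * schurSeq q x0 x1 (k - 2) := by
  obtain ⟨m, rfl | rfl⟩ : ∃ m : ℕ, k = (m : ℤ) + 2 ∨ k = 1 - (m : ℤ) := by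
    rcases le_total 2 k with h | h
    · exact ⟨(k - 2).toNat, Or.inl (by omega)⟩
    · rcases h.lt_or_eq with h | h
      · exact ⟨(1 - k).toNat, Or.inr (by omega)⟩
      · exact ⟨0, Or.inl (by omega)⟩
  · have e : ∀ j : ℕ, schurSeq q x0 x1 (j : ℤ) = schurFwd q x0 x1 j := fun j => by simp [schurSeq]
    have h0 := e m
    have h1 := e (m + 1)
    have h2 := e (m + 2)
    push_cast at h1 h2
    rw [show (m : ℤ) + 2 - 1 = m + 1 by ring, show (m : ℤ) + 2 - 2 = m by ring, h0, h1, h2,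
      schurFwd]
    norm_cast
  · have e : ∀ j : ℕ, schurSeq q x0 x1 (-(j : ℤ)) = schurBwd q x0 x1 j := by
      rintro (_ | j)
      · simp [schurSeq, schurFwd, schurBwd]
      · rw [schurSeq, if_neg (by omega), neg_neg, Int.toNat_natCast]
    rcases m with _ | m
    · have h0 := e 0
      have h1 := e 1
      have h : schurSeq q x0 x1 1 = x1 := by simp [schurSeq, schurFwd]
      simp only [schurBwd] at h0 h1
      push_cast at h0 h1
      norm_num
      rw [h, h1, show schurSeq q x0 x1 0 = x0 by simpa using h0]
      field_simp
      ring
    · have h0 := e m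
      have h1 := e (m + 1)
      have h2 := e (m + 2)
      push_cast at h1 h2 ⊢
      rw [show 1 - ((m : ℤ) + 1) = -m by ring, show -(m : ℤ) - 1 = -(m + 1) by ring,
        show -(m : ℤ) - 2 = -(m + 2) by ring, h0, h1, h2, schurBwd, zpow_neg, zpow_natCast]
      field_simp
      ring

theorem piK_rec {q : ℂ} (hq0 : q ≠ 0) (k : ℤ) :
    piK q k = piK q (k + 1) + q ^ (k + 1) * piK q (k + 2) := by
  have hD := schurSeq_rec hq0 1 (1 + q) k
  have hE := schurSeq_rec hq0 1 1 k
  have e0 : -(k * (k - 1) / 2) = -((k + 1) * (k + 1 - 1) / 2) + k := by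
    rw [show (k + 1) * (k + 1 - 1) = k * (k - 1) + 2 * k by ring,
      Int.add_mul_ediv_left _ _ (by norm_num)]
    ring
  have e2 : -((k + 2) * (k + 2 - 1) / 2) = -((k + 1) * (k + 1 - 1) / 2) - (k + 1) := by
    rw [show (k + 2) * (k + 2 - 1) = (k + 1) * (k + 1 - 1) + 2 * (k + 1) by ring,
      Int.add_mul_ediv_left _ _ (by norm_num)]
    ring
  unfold piK schurD schurE
  rw [e0, e2, show k + 1 - 2 = k - 1 by ring, show k + 2 - 2 = k by ring, hD, hE, zpow_add₀ hq0,
    zpow_sub₀ hq0, zpow_add₀ hq0, zpow_add₀ (by norm_num : (-1 : ℂ) ≠ 0),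
    zpow_add₀ (by norm_num : (-1 : ℂ) ≠ 0)]
  have hk : q ^ k ≠ 0 := zpow_ne_zero k hq0
  simp only [zpow_ofNat]
  field_simp
  ring

theorem piK_zero {q : ℂ} (hq0 : q ≠ 0) : piK q 0 = tht (q ^ 2) (q ^ 5) := by
  have hD : schurD q (-2) = 0 := by
    simp [schurD, schurSeq, schurBwd, hq0]
  have hE : schurE q (-2) = 1 := by
    simp [schurE, schurSeq, schurBwd]
  simp [piK, hD, hE]

theorem piK_one {q : ℂ} (hq0 : q ≠ 0) : piK q 1 = tht q (q ^ 5) := by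
  have hD : schurD q (-1) = 1 := by
    simp [schurD, schurSeq, schurBwd, hq0]
  have hE : schurE q (-1) = 0 := by
    simp [schurE, schurSeq, schurBwd]
  simp [piK, hD, hE]

end Schur

section Moments

/-- The operator `χ ↦ (m ↦ χ (m + 1) + χ (m - 1))` on two-sided sequences. -/
def neighborSum : Module.End ℂ (ℤ → ℂ) where
  toFun χ m := χ (m + 1) + χ (m - 1)
  map_add' χ ψ := by ext m; simp only [Pi.add_apply]; ring
  map_smul' a χ := by ext m; simp only [Pi.smul_apply, smul_eq_mul, RingHom.id_apply]; ring

/-- The polynomial `P` in `neighborSum`, applied to the sequence `ψ`. -/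
def polyAct (ψ : ℤ → ℂ) : ℂ[X] →ₗ[ℂ] (ℤ → ℂ) where
  toFun P := aeval neighborSum P ψ
  map_add' P Q := by simp
  map_smul' a P := by simp

theorem polyAct_mul (ψ : ℤ → ℂ) (P Q : ℂ[X]) :
    polyAct ψ (P * Q) = polyAct (polyAct ψ Q) P := by
  simp [polyAct]

theorem polyAct_one (ψ : ℤ → ℂ) : polyAct ψ 1 = ψ := by
  simp [polyAct]

theorem polyAct_X (ψ : ℤ → ℂ) (m : ℤ) : polyAct ψ X m = ψ (m + 1) + ψ (m - 1) := by
  simp [polyAct, neighborSum]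

theorem polyAct_C_mul (ψ : ℤ → ℂ) (a : ℂ) (P : ℂ[X]) (m : ℤ) :
    polyAct ψ (C a * P) m = a * polyAct ψ P m := by
  rw [← smul_eq_C_mul, map_smul, Pi.smul_apply, smul_eq_mul]

theorem polyAct_X_mul (ψ : ℤ → ℂ) (P : ℂ[X]) (m : ℤ) :
    polyAct ψ (X * P) m = polyAct ψ P (m + 1) + polyAct ψ P (m - 1) := by
  rw [polyAct_mul, polyAct_X]

theorem polyAct_reflect {ψ : ℤ → ℂ} {e ε : ℤ} (h : ∀ m, ψ (e - m) = ε * ψ m) (P : ℂ[X]) (m : ℤ) :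
    polyAct ψ P (e - m) = ε * polyAct ψ P m := by
  induction P using Polynomial.induction_on generalizing m with
  | C a => simpa [polyAct] using by rw [h]; ring
  | add P Q hP hQ => simp only [map_add, Pi.add_apply, hP, hQ]; ring
  | monomial n a ih =>
    rw [show C a * X ^ (n + 1) = X * (C a * X ^ n) by ring, polyAct_X_mul, polyAct_X_mul,
      show e - m + 1 = e - (m - 1) by ring, show e - m - 1 = e - (m + 1) by ring, ih, ih]
    ring

/-- The continuous `q`-Hermite polynomials with base `p`, in the variable `x + x⁻¹`. -/
def qHermite (p : ℂ) : ℕ → ℂ[X]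
  | 0 => 1
  | 1 => X
  | k + 2 => X * qHermite p (k + 1) - C (1 - p ^ (k + 1)) * qHermite p k

theorem polyAct_qHermite_add_two (ψ : ℤ → ℂ) (p : ℂ) (k : ℕ) (m : ℤ) :
    polyAct ψ (qHermite p (k + 2)) m = polyAct ψ (qHermite p (k + 1)) (m + 1) +
      polyAct ψ (qHermite p (k + 1)) (m - 1) - (1 - p ^ (k + 1)) * polyAct ψ (qHermite p k) m := by
  rw [qHermite, map_sub, Pi.sub_apply, polyAct_X_mul, polyAct_C_mul]

/-- The action on `ψ` of the `q`-Hermite polynomials with dilated argument `p ^ (-1/2) x`,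
multiplied by `p ^ (k / 2)`. -/
def dilatedHermite (p : ℂ) (ψ : ℤ → ℂ) : ℕ → ℤ → ℂ
  | 0, m => ψ m
  | 1, m => ψ (m + 1) + p * ψ (m - 1)
  | k + 2, m => dilatedHermite p ψ (k + 1) (m + 1) + p * dilatedHermite p ψ (k + 1) (m - 1) -
      p * (1 - p ^ (k + 1)) * dilatedHermite p ψ k m

theorem polyAct_qHermite_sub (p : ℂ) (ψ : ℤ → ℂ) (k : ℕ) (m : ℤ) :
    polyAct ψ (qHermite p (k + 1)) m - polyAct ψ (qHermite p k) (m - 1) =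
      dilatedHermite p ψ k (m + 1) := by
  induction k using Nat.twoStepInduction generalizing m with
  | zero => simp [qHermite, polyAct_X, polyAct_one, dilatedHermite]
  | one =>
    rw [polyAct_qHermite_add_two]
    simp only [qHermite, zero_add, polyAct_X, polyAct_one, dilatedHermite, add_sub_cancel_right]
    ring
  | more k ih0 ih1 =>
    have h1 := ih1 (m + 1)
    have h2 := ih1 (m - 1)
    have h3 := ih0 m
    have h4 := polyAct_qHermite_add_two ψ p (k + 1) m
    have h5 := polyAct_qHermite_add_two ψ p k (m - 1)
    simp only [add_sub_cancel_right, sub_add_cancel, add_assoc] at h1 h2 h4 h5 h3 ⊢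
    norm_num at h1 h2 h4 h5 h3 ⊢
    rw [dilatedHermite]
    rw [show m + 1 + 1 = m + 2 by ring, show m + 1 - 1 = m by ring]
    linear_combination h1 + p * h2 - p * (1 - p ^ (k + 1)) * h3 + h4 - p * h5

theorem dilatedHermite_reflect {p q : ℂ} (hq0 : q ≠ 0) (hp : p = q⁻¹) {ψ : ℤ → ℂ} {c : ℂ} {a b : ℤ}
    (h : ∀ j, ψ (a - j) = c * q ^ j * ψ (b + j)) (k : ℕ) (j : ℤ) :
    dilatedHermite p ψ k (a - j) = c * q ^ j * dilatedHermite p ψ k (b + j) := by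
  have hm (j : ℤ) : q ^ (j - 1) = q ^ j * p := by rw [zpow_sub₀ hq0, zpow_one, hp, div_eq_mul_inv]
  have hpl (j : ℤ) : p * q ^ (j + 1) = q ^ j := by
    rw [zpow_add₀ hq0, hp, zpow_one]
    field_simp
  induction k using Nat.twoStepInduction generalizing j with
  | zero => exact h j
  | one =>
    simp only [dilatedHermite]
    rw [show a - j + 1 = a - (j - 1) by ring, show a - j - 1 = a - (j + 1) by ring, h, h, hm,
      ← add_sub_assoc, ← add_assoc]
    linear_combination c * ψ (b + j + 1) * hpl j
  | more k ih0 ih1 =>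
    simp only [dilatedHermite]
    rw [show a - j + 1 = a - (j - 1) by ring, show a - j - 1 = a - (j + 1) by ring, ih1, ih1, ih0,
      hm, ← add_sub_assoc, ← add_assoc]
    linear_combination c * dilatedHermite p ψ (k + 1) (b + j + 1) * hpl j

/-- The reflection symmetries satisfied by the moments of the theta weight. -/
structure IsThetaMoment (s : ℂ) (δ : ℕ) (ψ : ℤ → ℂ) : Prop where
  reflect : ∀ m, ψ (-1 - δ - m) = ((-1) ^ δ : ℤ) * ψ m
  shift : ∀ j, ψ (2 - j) = (-1) ^ (δ + 1) * (s ^ δ)⁻¹ * (s ^ 2) ^ j * ψ (2 - δ + j)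

theorem IsThetaMoment.polyAct_qHermite_rec {s : ℂ} {δ : ℕ} {ψ : ℤ → ℂ} (h : IsThetaMoment s δ ψ)
    (hs : s ≠ 0) (hδ : δ = 0 ∨ δ = 1) (k : ℕ) :
    polyAct ψ (qHermite (s ^ 2)⁻¹ (k + 2)) 0 =
      (s ^ δ)⁻¹ * polyAct ψ (qHermite (s ^ 2)⁻¹ (k + 1)) 0 +
        (s ^ 2)⁻¹ ^ (k + 1) * polyAct ψ (qHermite (s ^ 2)⁻¹ k) 0 := by
  set p := (s ^ 2)⁻¹ with hp
  have e0 := polyAct_qHermite_add_two ψ p k 0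
  have e1 := polyAct_qHermite_sub p ψ k 1
  have e2 := polyAct_qHermite_sub p ψ k 0
  have e3 := dilatedHermite_reflect (pow_ne_zero 2 hs) hp h.shift k 0
  rcases hδ with rfl | rfl
  · have e4 := polyAct_reflect h.reflect (qHermite p (k + 1)) 0
    norm_num at e0 e1 e2 e3 e4 ⊢
    linear_combination e0 + e1 + e4 + e3 / 2
  · have e4 := polyAct_reflect h.reflect (qHermite p (k + 1)) (-1)
    have e5 := polyAct_reflect h.reflect (qHermite p k) (-1)
    norm_num at e0 e1 e2 e3 e4 e5 ⊢
    linear_combination e0 + e1 + e3 - s⁻¹ * e2 + e4 / 2 - s⁻¹ * e5 / 2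

end Moments

section HankelToToeplitz

/-- Polynomials `u_i` for which the moments of `u_i * qHermite p k` depend only on `i - k`, up to
scaling. -/
def toeplitzPoly (p d : ℂ) : ℕ → ℂ[X]
  | 0 => 1
  | 1 => C d * X - C (d ^ 2)
  | i + 2 => (C d * X - C (d ^ 2 * p ^ (i + 1))) * toeplitzPoly p d (i + 1) +
      C (d ^ 2 * p ^ (i + 1) - d ^ 2) * toeplitzPoly p d i

theorem qHermite_moment {L : ℂ[X] →ₗ[ℂ] ℂ} {q c d : ℂ} {δ : ℕ} {f : ℤ → ℂ} (hq0 : q ≠ 0)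
    (hd : d ^ 2 = q⁻¹ ^ δ) (hf : ∀ k, f k = f (k + 1) + q ^ (k + 1) * f (k + 2))
    (h0 : L 1 = c * f δ) (h1 : L X = c * d * f (δ - 1))
    (hL : ∀ k, L (qHermite q⁻¹ (k + 2)) =
      d * L (qHermite q⁻¹ (k + 1)) + q⁻¹ ^ (k + 1) * L (qHermite q⁻¹ k)) (k : ℕ) :
    L (qHermite q⁻¹ k) = c * d ^ k * f (δ - k) := by
  induction k using Nat.twoStepInduction with
  | zero => simpa [qHermite] using h0
  | one => simpa [qHermite] using h1
  | more k ih0 ih1 =>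
    have hk := hf (δ - k - 2)
    have e : d ^ 2 * q ^ ((δ : ℤ) - k - 2 + 1) = q⁻¹ ^ (k + 1) := by
      rw [hd, show (δ : ℤ) - k - 2 + 1 = δ - (k + 1 : ℕ) by push_cast; ring, zpow_sub₀ hq0,
        zpow_natCast, zpow_natCast, inv_pow, inv_pow]
      field_simp
    rw [hL, ih0, ih1]
    push_cast
    rw [show (δ : ℤ) - (k + 2) = δ - k - 2 by ring, show (δ : ℤ) - (k + 1) = δ - k - 1 by ring,
      hk, show (δ : ℤ) - k - 2 + 1 = δ - k - 1 by ring,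
      show (δ : ℤ) - k - 2 + 2 = δ - k by ring]
    rw [show (δ : ℤ) - k - 2 + 1 = δ - k - 1 by ring] at e
    linear_combination (-c * d ^ k * f (δ - k)) * e

theorem toeplitzPoly_moment {L : ℂ[X] →ₗ[ℂ] ℂ} {q c d : ℂ} {δ : ℕ} {f : ℤ → ℂ} (hq0 : q ≠ 0)
    (hd : d ^ 2 = q⁻¹ ^ δ) (hf : ∀ k, f k = f (k + 1) + q ^ (k + 1) * f (k + 2))
    (hL : ∀ k : ℕ, L (qHermite q⁻¹ k) = c * d ^ k * f (δ - k)) (i k : ℕ) :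
    L (toeplitzPoly q⁻¹ d i * qHermite q⁻¹ k) = c * d ^ k * f (δ + i - k) := by
  have smul (a : ℂ) (P : ℂ[X]) : L (C a * P) = a * L P := by
    rw [← smul_eq_C_mul, map_smul, smul_eq_mul]
  have hX (u : ℂ[X]) (e : ℤ) (hu : ∀ k : ℕ, L (u * qHermite q⁻¹ k) = c * d ^ k * f (e - k))
      (k : ℕ) : d * L (u * (X * qHermite q⁻¹ k)) =
        c * d ^ k * (d ^ 2 * f (e - k - 1) + (1 - q⁻¹ ^ k) * f (e - k + 1)) := by
    rcases k with _ | k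
    · have h := hu 1
      simp only [qHermite] at h ⊢
      rw [mul_one, h]
      simp
      ring
    · have h : u * (X * qHermite q⁻¹ (k + 1)) = u * qHermite q⁻¹ (k + 2) +
          C (1 - q⁻¹ ^ (k + 1)) * (u * qHermite q⁻¹ k) := by
        rw [qHermite]
        ring
      rw [h, map_add, smul, hu, hu]
      push_cast
      rw [show e - (k + 1) - 1 = e - (k + 2) by ring, show e - (k + 1) + 1 = e - k by ring]
      ring
  have hfq (i k : ℕ) : d ^ 2 * q⁻¹ ^ i * (f (δ + i - k - 1) - f (δ + i - k)) =
      q⁻¹ ^ k * f (δ + i - k + 1) := by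
    have h := hf (δ + i - k - 1)
    rw [show (δ : ℤ) + i - k - 1 + 1 = δ + i - k by ring,
      show (δ : ℤ) + i - k - 1 + 2 = δ + i - k + 1 by ring] at h
    rw [h, hd, zpow_sub₀ hq0, zpow_add₀ hq0]
    simp only [zpow_natCast, inv_pow]
    field_simp
    ring
  induction i using Nat.twoStepInduction generalizing k with
  | zero => simpa [toeplitzPoly] using hL k
  | one =>
    have h := hX 1 δ (by simpa using hL) k
    have h' := hfq 0 k
    have e : toeplitzPoly q⁻¹ d 1 * qHermite q⁻¹ k =
        C d * (1 * (X * qHermite q⁻¹ k)) - C (d ^ 2) * qHermite q⁻¹ k := by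
      rw [toeplitzPoly]
      ring
    rw [e, map_sub, smul, smul, h, hL]
    push_cast at h' ⊢
    rw [show (δ : ℤ) + 1 - k = δ - k + 1 by ring]
    simp only [add_zero, pow_zero, mul_one] at h'
    linear_combination c * d ^ k * h'
  | more i ih0 ih1 =>
    have h := hX (toeplitzPoly q⁻¹ d (i + 1)) (δ + (i + 1 : ℕ)) ih1 k
    have h' := hfq (i + 1) k
    have e : toeplitzPoly q⁻¹ d (i + 2) * qHermite q⁻¹ k =
        C d * (toeplitzPoly q⁻¹ d (i + 1) * (X * qHermite q⁻¹ k)) -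
          C (d ^ 2 * q⁻¹ ^ (i + 1)) * (toeplitzPoly q⁻¹ d (i + 1) * qHermite q⁻¹ k) +
          C (d ^ 2 * q⁻¹ ^ (i + 1) - d ^ 2) * (toeplitzPoly q⁻¹ d i * qHermite q⁻¹ k) := by
      rw [toeplitzPoly]
      ring
    rw [e, map_add, map_sub, smul, smul, smul, h, ih0, ih1]
    push_cast at h' ⊢
    rw [show (δ : ℤ) + (i + 1) - k - 1 = δ + i - k by ring] at h' ⊢
    rw [show (δ : ℤ) + (i + 2) - k = δ + (i + 1) - k + 1 by ring]
    linear_combination c * d ^ k * h'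

theorem coeff_of_three_term {P : ℕ → ℂ[X]} {a₀ a₁ α : ℂ} {β γ : ℕ → ℂ} (h0 : P 0 = C a₀)
    (h1 : ∃ b, P 1 = C a₁ * X + C b)
    (h : ∀ k, P (k + 2) = (C α * X + C (β k)) * P (k + 1) + C (γ k) * P k) :
    (∀ k, (P k).natDegree ≤ k) ∧ ∀ k, (P (k + 1)).coeff (k + 1) = α ^ k * a₁ := by
  obtain ⟨b, h1⟩ := h1
  have hdeg (k : ℕ) : (P k).natDegree ≤ k := by
    induction k using Nat.twoStepInduction with
    | zero => simp [h0]
    | one => rw [h1]; exact natDegree_linear_le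
    | more k ih0 ih1 =>
      rw [h]
      refine natDegree_add_le_of_degree_le ?_ ?_
      · exact (natDegree_mul_le_of_le natDegree_linear_le ih1).trans (by omega)
      · exact (natDegree_C_mul_le _ _).trans (by omega)
  refine ⟨hdeg, fun k => ?_⟩
  induction k with
  | zero => simp [h1]
  | succ k ih =>
    have e1 : (P (k + 1)).coeff (k + 2) = 0 :=
      coeff_eq_zero_of_natDegree_lt ((hdeg _).trans_lt (by omega))
    have e0 : (P k).coeff (k + 2) = 0 :=
      coeff_eq_zero_of_natDegree_lt ((hdeg _).trans_lt (by omega))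
    rw [h, add_mul, mul_assoc, coeff_add, coeff_add, coeff_C_mul, coeff_C_mul, coeff_C_mul,
      coeff_X_mul, ih, e0, e1]
    ring

theorem det_moment {n : ℕ} (L : ℂ[X] →ₗ[ℂ] ℂ) {P Q : ℕ → ℂ[X]}
    (hP : ∀ k, (P k).natDegree ≤ k) (hQ : ∀ k, (Q k).natDegree ≤ k) :
    (Matrix.of fun i j : Fin n => L (P i * Q j)).det =
      (∏ i : Fin n, (P i).coeff i) * (∏ i : Fin n, (Q i).coeff i) *
        (Matrix.of fun i j : Fin n => L (X ^ (i : ℕ) * X ^ (j : ℕ))).det := by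
  have hdet {R : ℕ → ℂ[X]} (hR : ∀ k, (R k).natDegree ≤ k) :
      (Matrix.of fun i j : Fin n => (R i).coeff j).det = ∏ i : Fin n, (R i).coeff i := by
    rw [Matrix.det_of_isLowerTriangular]
    · rfl
    · intro i j hij
      exact coeff_eq_zero_of_natDegree_lt ((hR i).trans_lt (by simpa using hij))
  have hsum {R : ℕ → ℂ[X]} (hR : ∀ k, (R k).natDegree ≤ k) (i : Fin n) :
      R i = ∑ k : Fin n, (R i).coeff k • X ^ (k : ℕ) := by
    conv_lhs => rw [as_sum_range_C_mul_X_pow' (R i) ((hR i).trans_lt i.2)]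
    rw [Finset.sum_range]
    simp only [smul_eq_C_mul]
  rw [← hdet hP, ← hdet hQ, ← Matrix.det_transpose (Matrix.of fun i j : Fin n => (Q i).coeff j),
    mul_right_comm, ← Matrix.det_mul, ← Matrix.det_mul]
  congr 1
  ext i j
  simp only [Matrix.of_apply, Matrix.mul_apply, Matrix.transpose_apply]
  conv_lhs => rw [hsum hP i, hsum hQ j, Finset.sum_mul_sum, Finset.sum_comm]
  simp only [map_sum, smul_mul_smul_comm, map_smul, smul_eq_mul, Finset.sum_mul]
  refine Finset.sum_congr rfl fun k _ => Finset.sum_congr rfl fun l _ => ?_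
  ring

end HankelToToeplitz

section ThetaDeterminant

/-- The moments of the theta weight: up to normalization, the sum of
`(-1) ^ N q ^ (5 N ^ 2 / 2) x ^ (m + (1 + δ) / 2)` over `x = q ^ N`, `N ∈ ℤ + δ / 2`. -/
def thetaMoment (s : ℂ) (δ : ℕ) (m : ℤ) : ℂ :=
  s ^ (δ * (m + 1)) * tht ((s ^ 2) ^ (m + 3 + 3 * δ)) ((s ^ 2) ^ 5)

theorem isThetaMoment_thetaMoment {s : ℂ} {δ : ℕ} (hs : s ≠ 0) (hs1 : ‖s ^ 2‖ < 1)
    (hδ : δ = 0 ∨ δ = 1) : IsThetaMoment s δ (thetaMoment s δ) := by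
  have hq : s ^ 2 ≠ 0 := pow_ne_zero 2 hs
  have e (k : ℤ) : (s ^ 2) ^ k = s ^ (2 * k) := by rw [zpow_mul]; norm_cast
  rcases hδ with rfl | rfl
  · constructor
    · intro m
      have h := tht_zpow_five_sub hq (m + 3)
      rw [show 5 - (m + 3) = -1 - m + 3 by ring] at h
      simpa [thetaMoment] using h
    · intro j
      have h := tht_zpow_five_sub hq j
      have h' := tht_zpow_add_five hq hs1 j
      simp only [thetaMoment]
      norm_num
      rw [show 2 - j + 3 = 5 - j by ring, show 2 + j + 3 = j + 5 by ring, h, h', zpow_neg]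
      field_simp
  · constructor
    · intro m
      have h := tht_zpow_five_sub hq (m + 1)
      have h' := tht_zpow_add_five hq hs1 (m + 1)
      simp only [thetaMoment]
      norm_num
      rw [show -2 - m + 3 + 3 = 5 - (m + 1) by ring, show m + 3 + 3 = m + 1 + 5 by ring, h, h',
        e (-(m + 1)), neg_mul, mul_neg, neg_neg, ← mul_assoc, ← zpow_add₀ hs]
      congr 2
      ring
    · intro j
      have h := tht_zpow_five_sub hq (j + 2)
      have h1 := tht_zpow_add_five hq hs1 (j + 2)
      have h2 := tht_zpow_add_five hq hs1 (3 - j)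
      rw [show 5 - (j + 2) = 3 - j by ring] at h
      simp only [thetaMoment]
      norm_num
      rw [show 2 - j + 3 + 3 = 3 - j + 5 by ring, show 1 + j + 3 + 3 = j + 2 + 5 by ring, h1, h2, h,
        e (-(3 - j)), e j, e (-(j + 2))]
      have key : s ^ (2 - j + 1) * s ^ (2 * -(3 - j)) =
          s⁻¹ * s ^ (2 * j) * (s ^ (1 + j + 1) * s ^ (2 * -(j + 2))) := by
        rw [← zpow_neg_one, ← zpow_add₀ hs, ← zpow_add₀ hs, ← zpow_add₀ hs, ← zpow_add₀ hs]
        congr 1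
        ring
      linear_combination (-tht ((s ^ 2) ^ (j + 2)) ((s ^ 2) ^ 5)) * key

theorem zpow_mul_tht_eq_thetaMoment {s : ℂ} {δ : ℕ} (hs : s ≠ 0) (hs1 : ‖s ^ 2‖ < 1)
    (hδ : δ = 0 ∨ δ = 1) (a : ℕ) (m : ℤ) :
    s ^ (m * (2 * a + δ)) * tht ((s ^ 2) ^ (4 * (a : ℤ) + 2 + 2 * δ + m)) ((s ^ 2) ^ 5) =
      (-1) ^ δ * (-1) ^ a * s ^ (δ - 3 * (a : ℤ) ^ 2 + a - 3 * δ * a) * thetaMoment s δ (a - m) := by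
  have hq : s ^ 2 ≠ 0 := pow_ne_zero 2 hs
  have e (k : ℤ) : (s ^ 2) ^ k = s ^ (2 * k) := by rw [zpow_mul]; norm_cast
  induction a generalizing m with
  | zero =>
    have h := (isThetaMoment_thetaMoment hs hs1 hδ).reflect (m - 1 - δ)
    rw [show -1 - (δ : ℤ) - (m - 1 - δ) = (0 : ℕ) - m by push_cast; ring] at h
    rw [h, thetaMoment]
    rcases hδ with rfl | rfl
    · norm_num
      congr 2
      ring
    · norm_num
      rw [show m - 1 - 1 + 3 + 3 = 2 + 2 + m by ring, ← mul_assoc, ← zpow_one_add₀ hs]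
      congr 2
      ring
  | succ a ih =>
    have h := tht_zpow_add_five hq hs1 (4 * (a : ℤ) + 2 + 2 * δ + (m - 1))
    have ih' := ih (m - 1)
    push_cast
    rw [show 4 * ((a : ℤ) + 1) + 2 + 2 * δ + m = 4 * (a : ℤ) + 2 + 2 * δ + (m - 1) + 5 by ring, h, e,
      show (a : ℤ) + 1 - m = a - (m - 1) by ring, pow_succ (-1 : ℂ) a]
    have k1 : s ^ (m * (2 * ((a : ℤ) + 1) + δ)) * s ^ (2 * -(4 * (a : ℤ) + 2 + 2 * δ + (m - 1))) =
        s ^ (-6 * (a : ℤ) - 2 - 3 * δ) * s ^ ((m - 1) * (2 * (a : ℤ) + δ)) := by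
      rw [← zpow_add₀ hs, ← zpow_add₀ hs]
      congr 1
      ring
    have k2 : s ^ ((δ : ℤ) - 3 * ((a : ℤ) + 1) ^ 2 + (a + 1) - 3 * δ * (a + 1)) =
        s ^ (-6 * (a : ℤ) - 2 - 3 * δ) * s ^ ((δ : ℤ) - 3 * (a : ℤ) ^ 2 + a - 3 * δ * a) := by
      rw [← zpow_add₀ hs]
      congr 1
      ring
    rw [k2]
    linear_combination
      (-tht ((s ^ 2) ^ (4 * (a : ℤ) + 2 + 2 * δ + (m - 1))) ((s ^ 2) ^ 5)) * k1 -
        s ^ (-6 * (a : ℤ) - 2 - 3 * δ) * ih'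

theorem polyAct_chebyshevC (ψ : ℤ → ℂ) (k : ℕ) (m : ℤ) :
    polyAct ψ (Chebyshev.C ℂ k) m = ψ (m + k) + ψ (m - k) := by
  induction k using Nat.twoStepInduction generalizing m with
  | zero =>
    have h := polyAct_C_mul ψ 2 1 m
    rw [polyAct_one, mul_one] at h
    simp only [Nat.cast_zero, Chebyshev.C_zero, add_zero, sub_zero]
    rw [← two_mul, ← h]
    rfl
  | one => simp [polyAct_X]
  | more k ih0 ih1 =>
    push_cast at ih1 ⊢
    rw [Chebyshev.C_add_two, map_sub, Pi.sub_apply, polyAct_X_mul, ih0, ih1, ih1]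
    ring_nf

/-- The polynomials in `x + x⁻¹` equal to the quotient of
`x ^ (a + (δ + 1) / 2) + (-1) ^ δ x ^ (-a - (δ + 1) / 2)` by its value at `a = 0`. -/
def charQuotient (δ a : ℕ) : ℂ[X] :=
  Chebyshev.S ℂ a - C (1 - δ : ℂ) * Chebyshev.S ℂ (a - 1)

theorem charQuotient_add_two (δ a : ℕ) :
    charQuotient δ (a + 2) = X * charQuotient δ (a + 1) - charQuotient δ a := by
  have h1 := Chebyshev.S_add_two ℂ a
  have h2 := Chebyshev.S_add_two ℂ (a - 1)
  rw [show (a : ℤ) - 1 + 2 = a + 1 by ring, sub_add_cancel] at h2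
  simp only [charQuotient]
  push_cast
  rw [show (a : ℤ) + 2 - 1 = a + 1 by ring, add_sub_cancel_right]
  linear_combination h1 - C (1 - δ : ℂ) * h2

theorem polyAct_charQuotient {δ : ℕ} {ψ : ℤ → ℂ} (hδ : δ = 0 ∨ δ = 1)
    (h : ∀ m, ψ (-1 - δ - m) = ((-1) ^ δ : ℤ) * ψ m) (a : ℕ) :
    polyAct ψ (charQuotient δ a) 0 = ψ a := by
  induction a using Nat.twoStepInduction generalizing ψ with
  | zero => simp [charQuotient, polyAct_one]
  | one =>
    have h' := h (-1)
    rcases hδ with rfl | rfl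
    · norm_num at h'
      simp [charQuotient, polyAct_one, polyAct_X, h']
    · norm_num at h'
      simp only [charQuotient]
      norm_num [polyAct_X]
      linear_combination h' / 2
  | more a ih0 ih1 =>
    have hX := ih1 (ψ := polyAct ψ X) (polyAct_reflect h X)
    rw [charQuotient_add_two, map_sub, Pi.sub_apply, mul_comm, polyAct_mul, hX, ih0 h, polyAct_X]
    push_cast
    ring_nf

theorem sign_revPerm (n : ℕ) :
    ((Equiv.Perm.sign (Fin.revPerm : Equiv.Perm (Fin n)) : ℤˣ) : ℤ) =
      ∏ a ∈ Finset.range n, (-1) ^ a := by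
  rw [Equiv.Perm.sign_eq_prod_prod_Ioi, ← Finset.prod_range_reflect, Finset.prod_range]
  push_cast
  refine Finset.prod_congr rfl fun i _ => ?_
  rw [Finset.prod_congr rfl (g := fun _ => (-1 : ℤ))]
  · rw [Finset.prod_const, Fin.card_Ioi]
  · intro j hj
    have hij : i < j := by simpa using hj
    simp [hij.le]

theorem prod_theta_prefactor {s : ℂ} (hs : s ≠ 0) (δ n : ℕ) :
    ∏ a ∈ Finset.range n, ((-1) ^ a *
        ((-1) ^ δ * (-1) ^ a * s ^ ((δ : ℤ) - 3 * (a : ℤ) ^ 2 + a - 3 * δ * a))) =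
      ((-1) ^ δ * s ^ δ) ^ n * s ^ (((n : ℤ) * (n - 1) * (2 - 2 * n - 3 * δ)) / 2) := by
  induction n with
  | zero => simp
  | succ n ih =>
    have e : ((n + 1 : ℕ) : ℤ) * ((n + 1 : ℕ) - 1) * (2 - 2 * (n + 1 : ℕ) - 3 * δ) =
        n * (n - 1) * (2 - 2 * n - 3 * δ) + 2 * (-3 * n ^ 2 + n - 3 * δ * n) := by
      push_cast
      ring
    have e' : s ^ ((δ : ℤ) - 3 * (n : ℤ) ^ 2 + n - 3 * δ * n) =
        s ^ δ * s ^ (-3 * (n : ℤ) ^ 2 + n - 3 * δ * n) := by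
      rw [← zpow_natCast, ← zpow_add₀ hs]
      congr 1
      ring
    have hsq : ((-1 : ℂ) ^ n) ^ 2 = 1 := by rw [← pow_mul, mul_comm, pow_mul]; simp
    rw [Finset.prod_range_succ, ih, e, Int.add_mul_ediv_left _ _ (by norm_num), zpow_add₀ hs, e',
      pow_succ (_ * _) n]
    generalize s ^ (-3 * (n : ℤ) ^ 2 + n - 3 * δ * n) = u
    generalize s ^ (((n : ℤ) * (n - 1) * (2 - 2 * n - 3 * δ)) / 2) = v
    linear_combination ((-1) ^ δ * s ^ δ) ^ n * v * (-1) ^ δ * s ^ δ * u * hsq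

end ThetaDeterminant

section Determinants

theorem coeff_qHermite (p : ℂ) :
    (∀ k, (qHermite p k).natDegree ≤ k) ∧ ∀ k, (qHermite p k).coeff k = 1 := by
  obtain ⟨h, h'⟩ := coeff_of_three_term (P := qHermite p) (a₀ := 1) (a₁ := 1) (α := 1)
    (β := fun _ => 0) (γ := fun k => -(1 - p ^ (k + 1))) (by simp [qHermite])
    ⟨0, by simp [qHermite]⟩ (fun k => by rw [qHermite, C_neg, C_1, C_0]; ring)
  refine ⟨h, fun k => ?_⟩
  rcases k with _ | k
  · simp [qHermite]
  · simp [h']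

theorem coeff_toeplitzPoly (p d : ℂ) :
    (∀ k, (toeplitzPoly p d k).natDegree ≤ k) ∧ ∀ k, (toeplitzPoly p d k).coeff k = d ^ k := by
  obtain ⟨h, h'⟩ := coeff_of_three_term (P := toeplitzPoly p d) (a₀ := 1) (a₁ := d) (α := d)
    (β := fun k => -(d ^ 2 * p ^ (k + 1))) (γ := fun k => d ^ 2 * p ^ (k + 1) - d ^ 2)
    (by simp [toeplitzPoly])
    ⟨-d ^ 2, by rw [toeplitzPoly, C_neg]; ring⟩ (fun k => by rw [toeplitzPoly, C_neg]; ring)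
  refine ⟨h, fun k => ?_⟩
  rcases k with _ | k
  · simp [toeplitzPoly]
  · rw [h', pow_succ]

theorem coeff_charQuotient (δ : ℕ) :
    (∀ k, (charQuotient δ k).natDegree ≤ k) ∧ ∀ k, (charQuotient δ k).coeff k = 1 := by
  obtain ⟨h, h'⟩ := coeff_of_three_term (P := charQuotient δ) (a₀ := 1) (a₁ := 1) (α := 1)
    (β := fun _ => 0) (γ := fun _ => -1) (by simp [charQuotient])
    ⟨-(1 - δ), by simp [charQuotient]; ring⟩
    (fun k => by rw [charQuotient_add_two, C_neg, C_1, C_0]; ring)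
  refine ⟨h, fun k => ?_⟩
  rcases k with _ | k
  · simp [charQuotient]
  · simp [h']

theorem coeff_chebyshevC :
    (∀ k : ℕ, (Chebyshev.C ℂ k).natDegree ≤ k) ∧
      ∀ k : ℕ, (Chebyshev.C ℂ (k + 1 : ℕ)).coeff (k + 1) = 1 := by
  obtain ⟨h, h'⟩ := coeff_of_three_term (P := fun k : ℕ => Chebyshev.C ℂ k) (a₀ := 2) (a₁ := 1)
    (α := 1) (β := fun _ => 0) (γ := fun _ => -1)
    (by simp only [Nat.cast_zero, Chebyshev.C_zero, map_ofNat]) ⟨0, by simp⟩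
    (fun k => by
      push_cast
      rw [Chebyshev.C_add_two, C_neg, C_1, C_0]
      ring)
  exact ⟨h, fun k => by simpa using h' k⟩

/-- The functional on polynomials in `x + x⁻¹` defined by the theta weight. -/
def thetaFunctional (s : ℂ) (δ : ℕ) : ℂ[X] →ₗ[ℂ] ℂ :=
  LinearMap.proj 0 ∘ₗ polyAct (thetaMoment s δ)

theorem thetaFunctional_apply (s : ℂ) (δ : ℕ) (P : ℂ[X]) :
    thetaFunctional s δ P = polyAct (thetaMoment s δ) P 0 := rfl

theorem thetaFunctional_one {s : ℂ} {δ : ℕ} (hs : s ≠ 0) (hs1 : ‖s ^ 2‖ < 1)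
    (hδ : δ = 0 ∨ δ = 1) :
    thetaFunctional s δ 1 = (-1) ^ δ * (s ^ δ)⁻¹ * piK (s ^ 2) δ := by
  have hq : s ^ 2 ≠ 0 := pow_ne_zero 2 hs
  rw [thetaFunctional_apply, polyAct_one, thetaMoment]
  rcases hδ with rfl | rfl
  · have h := tht_zpow_five_sub hq 2
    norm_num at h ⊢
    rw [piK_zero hq]
    exact_mod_cast h
  · have h := tht_zpow_add_five hq hs1 1
    norm_num at h ⊢
    rw [piK_one hq, h]
    field_simp

theorem thetaFunctional_X {s : ℂ} {δ : ℕ} (hs : s ≠ 0) (hs1 : ‖s ^ 2‖ < 1)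
    (hδ : δ = 0 ∨ δ = 1) :
    thetaFunctional s δ X = (-1) ^ δ * (s ^ δ)⁻¹ * (s ^ δ)⁻¹ * piK (s ^ 2) (δ - 1) := by
  have hq : s ^ 2 ≠ 0 := pow_ne_zero 2 hs
  rw [thetaFunctional_apply, polyAct_X]
  rcases hδ with rfl | rfl
  · have h := tht_zpow_five_sub hq 1
    have hr := piK_rec hq (-1)
    norm_num at h hr ⊢
    rw [hr, piK_zero hq, piK_one hq]
    simp only [thetaMoment]
    norm_num
    rw [h]
    ring
  · have h := tht_zpow_add_five hq hs1 2
    have hr := (isThetaMoment_thetaMoment hs hs1 (Or.inr rfl)).reflect (-1)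
    have hm : thetaMoment s 1 (-1) = 0 := by
      norm_num at hr
      linear_combination hr / 2
    norm_num at h ⊢
    rw [hm, piK_zero hq, thetaMoment]
    norm_num
    rw [h]
    field_simp

theorem det_piK_eq_det_thetaFunctional {s : ℂ} {δ : ℕ} (hs : s ≠ 0) (hs1 : ‖s ^ 2‖ < 1)
    (hδ : δ = 0 ∨ δ = 1) (n : ℕ) :
    ((-1) ^ δ * s ^ δ) ^ n * (Matrix.of fun i j : Fin n =>
        thetaFunctional s δ (X ^ (i : ℕ) * X ^ (j : ℕ))).det =
      (Matrix.of fun i j : Fin n => piK (s ^ 2) ((δ : ℤ) + (i : ℕ) - (j : ℕ))).det := by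
  have hq : s ^ 2 ≠ 0 := pow_ne_zero 2 hs
  have hd0 : (s ^ δ)⁻¹ ≠ 0 := inv_ne_zero (pow_ne_zero δ hs)
  have hd : (s ^ δ)⁻¹ ^ 2 = (s ^ 2)⁻¹ ^ δ := by
    rw [← inv_pow, ← inv_pow, ← pow_mul, ← pow_mul, mul_comm]
  have hP := coeff_toeplitzPoly (s ^ 2)⁻¹ (s ^ δ)⁻¹
  have hQ := coeff_qHermite (s ^ 2)⁻¹
  have hdet := det_moment (n := n) (thetaFunctional s δ) hP.1 hQ.1
  have hmom := toeplitzPoly_moment hq hd (piK_rec hq) (qHermite_moment hq hd (piK_rec hq)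
    (thetaFunctional_one hs hs1 hδ) (thetaFunctional_X hs hs1 hδ)
    ((isThetaMoment_thetaMoment hs hs1 hδ).polyAct_qHermite_rec hs hδ))
  have hcol := Matrix.det_mul_row (fun j : Fin n => (-1) ^ δ * (s ^ δ)⁻¹ * (s ^ δ)⁻¹ ^ (j : ℕ))
    (Matrix.of fun i j : Fin n => piK (s ^ 2) ((δ : ℤ) + (i : ℕ) - (j : ℕ)))
  simp only [Matrix.of_apply] at hcol
  simp only [hmom, hP.2, hQ.2, Finset.prod_const_one, mul_one] at hdet
  rw [hcol, Finset.prod_mul_distrib, Finset.prod_const, Finset.card_univ, Fintype.card_fin] at hdet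
  have hprod : ∏ i : Fin n, (s ^ δ)⁻¹ ^ (i : ℕ) ≠ 0 :=
    Finset.prod_ne_zero_iff.mpr fun i _ => pow_ne_zero _ hd0
  have hsq : ((-1 : ℂ) ^ δ) ^ 2 = 1 := by rw [← pow_mul, mul_comm, pow_mul]; simp
  have hc : ((-1) ^ δ * s ^ δ) ^ n * ((-1) ^ δ * (s ^ δ)⁻¹) ^ n = 1 := by
    rw [← mul_pow, mul_mul_mul_comm, ← sq, hsq, mul_inv_cancel₀ (pow_ne_zero δ hs), one_mul,
      one_pow]
  apply mul_left_cancel₀ hprod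
  linear_combination (-((-1) ^ δ * s ^ δ) ^ n) * hdet + (∏ i : Fin n, (s ^ δ)⁻¹ ^ (i : ℕ)) *
    (Matrix.of fun i j : Fin n => piK (s ^ 2) ((δ : ℤ) + (i : ℕ) - (j : ℕ))).det * hc

theorem tht_add_tht_eq_thetaFunctional {s : ℂ} {δ : ℕ} (hs : s ≠ 0) (hs1 : ‖s ^ 2‖ < 1)
    (hδ : δ = 0 ∨ δ = 1) (a j : ℕ) :
    s ^ ((j : ℤ) * (2 * a + δ)) *
          tht ((s ^ 2) ^ (4 * (a : ℤ) + 2 + 2 * δ + j)) ((s ^ 2) ^ 5) +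
        s ^ (-((j : ℤ) * (2 * a + δ))) *
          tht ((s ^ 2) ^ (4 * (a : ℤ) + 2 + 2 * δ - j)) ((s ^ 2) ^ 5) =
      (-1) ^ δ * (-1) ^ a * s ^ (δ - 3 * (a : ℤ) ^ 2 + a - 3 * δ * a) *
        thetaFunctional s δ (charQuotient δ a * Chebyshev.C ℂ j) := by
  have h := (isThetaMoment_thetaMoment hs hs1 hδ).reflect
  have h1 := zpow_mul_tht_eq_thetaMoment hs hs1 hδ a j
  have h2 := zpow_mul_tht_eq_thetaMoment hs hs1 hδ a (-j)
  rw [neg_mul, ← sub_eq_add_neg, sub_neg_eq_add] at h2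
  rw [thetaFunctional_apply, polyAct_mul, polyAct_charQuotient hδ (polyAct_reflect h _),
    polyAct_chebyshevC, h1, h2]
  ring

theorem det_theta_eq_det_thetaFunctional {s : ℂ} {δ : ℕ} (hs : s ≠ 0) (hs1 : ‖s ^ 2‖ < 1)
    (hδ : δ = 0 ∨ δ = 1) {n : ℕ} (hn : 0 < n) :
    (Matrix.of fun i j : Fin n =>
        s ^ ((j : ℕ) * (2 * ((n : ℤ) - 1 - (i : ℕ)) + δ)) *
            tht ((s ^ 2) ^ (4 * (n : ℤ) + 2 * δ - 2 - 4 * (i : ℕ) + (j : ℕ))) ((s ^ 2) ^ 5) +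
          s ^ (-((j : ℕ) * (2 * ((n : ℤ) - 1 - (i : ℕ)) + δ))) *
            tht ((s ^ 2) ^ (4 * (n : ℤ) + 2 * δ - 2 - 4 * (i : ℕ) - (j : ℕ))) ((s ^ 2) ^ 5)).det =
      2 * s ^ (((n : ℤ) * (n - 1) * (2 - 2 * n - 3 * δ)) / 2) * (((-1) ^ δ * s ^ δ) ^ n *
        (Matrix.of fun i j : Fin n => thetaFunctional s δ (X ^ (i : ℕ) * X ^ (j : ℕ))).det) := by
  have hP := coeff_charQuotient δ
  have hC : ∏ j : Fin n, (Chebyshev.C ℂ (j : ℕ)).coeff (j : ℕ) = 2 := by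
    obtain ⟨n, rfl⟩ := Nat.exists_eq_add_one.mpr hn
    rw [Fin.prod_univ_succ]
    simp only [Fin.val_succ, coeff_chebyshevC.2, Finset.prod_const_one, Fin.val_zero, Nat.cast_zero,
      Chebyshev.C_zero, mul_one]
    exact coeff_C_zero (a := (2 : ℂ))
  have hdet := det_moment (n := n) (thetaFunctional s δ) (Q := fun k : ℕ => Chebyshev.C ℂ k) hP.1
    coeff_chebyshevC.1
  simp only [hP.2, Finset.prod_const_one, one_mul, hC] at hdet
  have hrow := Matrix.det_mul_column
    (fun i : Fin n => (-1) ^ δ * (-1) ^ (i : ℕ) *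
      s ^ ((δ : ℤ) - 3 * ((i : ℕ) : ℤ) ^ 2 + (i : ℕ) - 3 * δ * (i : ℕ)))
    (Matrix.of fun i j : Fin n => thetaFunctional s δ (charQuotient δ i * Chebyshev.C ℂ (j : ℕ)))
  rw [hdet] at hrow
  have hpre := prod_theta_prefactor hs δ n
  rw [Finset.prod_mul_distrib, Finset.prod_range fun a : ℕ => (-1 : ℂ) ^ δ * (-1) ^ a *
    s ^ ((δ : ℤ) - 3 * (a : ℤ) ^ 2 + a - 3 * δ * a)] at hpre
  have hsign := congrArg (Int.cast : ℤ → ℂ) (sign_revPerm n)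
  push_cast at hsign
  have hperm := Matrix.det_permute (Fin.revPerm : Equiv.Perm (Fin n)) (Matrix.of fun i j : Fin n =>
    (-1) ^ δ * (-1) ^ (i : ℕ) * s ^ ((δ : ℤ) - 3 * ((i : ℕ) : ℤ) ^ 2 + (i : ℕ) - 3 * δ * (i : ℕ)) *
      thetaFunctional s δ (charQuotient δ i * Chebyshev.C ℂ (j : ℕ)))
  simp only [Matrix.of_apply] at hrow
  rw [hrow, hsign, ← mul_assoc, hpre] at hperm
  trans; swap
  · exact hperm.trans (by ring)
  · congr 1
    ext i j
    have h := tht_add_tht_eq_thetaFunctional hs hs1 hδ (Fin.rev i) j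
    have hi : (((Fin.rev i : Fin n) : ℕ) : ℤ) = n - 1 - (i : ℕ) := by
      rw [Fin.val_rev]
      omega
    simp only [Matrix.submatrix_apply, Matrix.of_apply, Fin.revPerm_apply, id_eq]
    rw [← h, hi, show 4 * ((n : ℤ) - 1 - (i : ℕ)) + 2 + 2 * δ = 4 * n + 2 * δ - 2 - 4 * (i : ℕ) by
      ring]

end Determinants

/-- The `D_n` determinant transformation identity: an `A_n`-type Toeplitz determinant of
the `π_k` equals a `D_n`-type determinant of theta functions. -/
theorem Dn_determinant_transformation (n : ℕ) (hn : 0 < n) (δ : ℕ) (hδ : δ = 0 ∨ δ = 1)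
    (q sqq : ℂ) (hq0 : 0 < ‖q‖) (hq1 : ‖q‖ < 1) (hsq : sqq ^ 2 = q) :
    2 * sqq ^ (((n : ℤ) * ((n : ℤ) - 1) * (2 - 2 * (n : ℤ) - 3 * (δ : ℤ))) / 2) *
        Matrix.det (Matrix.of fun i j : Fin n =>
          piK q ((δ : ℤ) + ((i : ℕ) : ℤ) - ((j : ℕ) : ℤ)))
      = Matrix.det (Matrix.of fun i j : Fin n =>
          sqq ^ (((j : ℕ) : ℤ) * (2 * ((n : ℤ) - 1 - ((i : ℕ) : ℤ)) + (δ : ℤ))) *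
              tht (q ^ (4 * (n : ℤ) + 2 * (δ : ℤ) - 2 - 4 * ((i : ℕ) : ℤ) + ((j : ℕ) : ℤ))) (q ^ 5)
            + sqq ^ (-(((j : ℕ) : ℤ) * (2 * ((n : ℤ) - 1 - ((i : ℕ) : ℤ)) + (δ : ℤ)))) *
              tht (q ^ (4 * (n : ℤ) + 2 * (δ : ℤ) - 2 - 4 * ((i : ℕ) : ℤ) - ((j : ℕ) : ℤ))) (q ^ 5)) := by
  subst hsq
  have hs : sqq ≠ 0 := by
    rintro rfl
    simp at hq0
  rw [det_theta_eq_det_thetaFunctional hs hq1 hδ hn, det_piK_eq_det_thetaFunctional hs hq1 hδ n]
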